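/- arXiv:2312.04371 — 2 statements merged into one kernel-verified Lean document; each statement's English description precedes it below -/
import Mathlib

section
/- Let f, g : A → ℝ be bounded measurable functions and ε ≥ 0. If osc(f − g) ≤ ε, then |D_KL(π·μ ‖ Gibbs(f)) − D_KL(π·μ ‖ Gibbs(g))| ≤ ε. (This is the one-step KL perturbation bound underlying each of the two terms in the proof of Proposition 2 of the paper.) -/
open MeasureTheory Real

/-- Partition function `Z(f) = ∫ exp (f a) dμ(a)`. -/
noncomputable def partitionZ {A : Type*} [MeasurableSpace A] (μ : Measure A) (f : A → ℝ) : ℝ :=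
  ∫ a, Real.exp (f a) ∂μ

/-- Gibbs measure with density `exp f / Z(f)` with respect to `μ`. -/
noncomputable def gibbs {A : Type*} [MeasurableSpace A] (μ : Measure A) (f : A → ℝ) :
    Measure A :=
  μ.withDensity (fun a => ENNReal.ofReal (Real.exp (f a) / partitionZ μ f))

/-- Kullback–Leibler divergence `D_KL(P ‖ Q) = ∫ log (dP/dQ) dP`. -/
noncomputable def klDiv {A : Type*} [MeasurableSpace A] (P Q : Measure A) : ℝ :=
  ∫ a, MeasureTheory.llr P Q a ∂P

theorem gibbs_eq_tilted {A : Type*} [MeasurableSpace A] (μ : Measure A) (f : A → ℝ) :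
    gibbs μ f = μ.tilted f := rfl

/-- A bounded measurable function is integrable for every finite measure. -/
theorem integrable_of_abs_le {A : Type*} [MeasurableSpace A] (P : Measure A) [IsFiniteMeasure P]
    {f : A → ℝ} (hfm : Measurable f) (hfB : ∃ C, ∀ a, |f a| ≤ C) : Integrable f P := by
  obtain ⟨C, hC⟩ := hfB
  exact .of_bound hfm.aestronglyMeasurable C (.of_forall hC)

theorem integrable_exp_of_abs_le {A : Type*} [MeasurableSpace A] (P : Measure A)
    [IsFiniteMeasure P] {f : A → ℝ} (hfm : Measurable f) (hfB : ∃ C, ∀ a, |f a| ≤ C) :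
    Integrable (fun a => Real.exp (f a)) P := by
  obtain ⟨C, hC⟩ := hfB
  refine integrable_of_abs_le P hfm.exp ⟨Real.exp C, fun a => ?_⟩
  rw [abs_of_pos (Real.exp_pos _)]
  exact Real.exp_le_exp.mpr ((le_abs_self _).trans (hC a))

theorem integrable_llr_withDensity {A : Type*} [MeasurableSpace A] (μ : Measure A)
    [IsFiniteMeasure μ] {p : A → ℝ} (hpm : Measurable p) (hp0 : ∀ a, 0 ≤ p a)
    (hp : Integrable (fun a => p a * |Real.log (p a)|) μ) :
    Integrable (llr (μ.withDensity (fun a => ENNReal.ofReal (p a))) μ)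
      (μ.withDensity (fun a => ENNReal.ofReal (p a))) := by
  have : SigmaFinite (μ.withDensity (fun a => ENNReal.ofReal (p a))) :=
    SigmaFinite.withDensity_ofReal _
  rw [← integrable_rnDeriv_mul_log_iff (withDensity_absolutelyContinuous _ _)]
  have key : Integrable (fun a => p a * Real.log (p a)) μ := by
    refine hp.mono (hpm.mul hpm.log).aestronglyMeasurable (.of_forall fun a => ?_)
    simp
  refine key.congr ?_
  filter_upwards [Measure.rnDeriv_withDensity μ hpm.ennreal_ofReal] with a ha
  rw [ha, ENNReal.toReal_ofReal (hp0 a)]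

/-- One-sided perturbation bound for the log-partition function, averaged against `P`. -/
theorem log_partitionZ_sub_le {A : Type*} [MeasurableSpace A] (μ P : Measure A)
    [IsFiniteMeasure μ] [IsProbabilityMeasure P] (hμ : μ ≠ 0) {f g : A → ℝ}
    (hfm : Measurable f) (hgm : Measurable g)
    (hfB : ∃ C, ∀ a, |f a| ≤ C) (hgB : ∃ C, ∀ a, |g a| ≤ C) {ε : ℝ}
    (hosc : ∀ a a', (f a - g a) - (f a' - g a') ≤ ε) :
    Real.log (partitionZ μ f) - Real.log (partitionZ μ g) ≤
      ε + (∫ a, f a ∂P - ∫ a, g a ∂P) := by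
  have : NeZero μ := ⟨hμ⟩
  have hf := integrable_exp_of_abs_le μ hfm hfB
  have hg := integrable_exp_of_abs_le μ hgm hgB
  have hZf : 0 < partitionZ μ f := integral_exp_pos hf
  have hZg : 0 < partitionZ μ g := integral_exp_pos hg
  have hfP := integrable_of_abs_le P hfm hfB
  have hgP := integrable_of_abs_le P hgm hgB
  have pointwise (b : A) :
      Real.log (partitionZ μ f) - Real.log (partitionZ μ g) - ε ≤ f b - g b := by
    have hZ : partitionZ μ f ≤ Real.exp (ε + (f b - g b)) * partitionZ μ g := by
      unfold partitionZ
      rw [← integral_const_mul]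
      refine integral_mono hf (hg.const_mul _) fun a => ?_
      change Real.exp (f a) ≤ Real.exp (ε + (f b - g b)) * Real.exp (g a)
      rw [← Real.exp_add]
      exact Real.exp_le_exp.mpr (by linarith [hosc a b])
    have hlog := Real.log_le_log hZf hZ
    rw [Real.log_mul (Real.exp_pos _).ne' hZg.ne', Real.log_exp] at hlog
    linarith
  have h := integral_mono (μ := P) (integrable_const _) (hfP.sub hgP) pointwise
  simp only [integral_const, probReal_univ, one_smul, Pi.sub_apply] at h
  rw [integral_sub hfP hgP] at h
  linarith

theorem klDiv_gibbs {A : Type*} [MeasurableSpace A] (μ P : Measure A)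
    [IsFiniteMeasure μ] [IsProbabilityMeasure P] (hP : P ≪ μ) (hint : Integrable (llr P μ) P)
    {f : A → ℝ} (hfm : Measurable f) (hfB : ∃ C, ∀ a, |f a| ≤ C) :
    klDiv P (gibbs μ f) = ∫ a, llr P μ a ∂P - ∫ a, f a ∂P + Real.log (partitionZ μ f) := by
  rw [klDiv, gibbs_eq_tilted, partitionZ]
  exact integral_llr_tilted_right hP (integrable_of_abs_le P hfm hfB)
    (integrable_exp_of_abs_le μ hfm hfB) hint

theorem stmt_1 {A : Type*} [MeasurableSpace A] (μ : Measure A) [IsFiniteMeasure μ]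
    (hμ : μ ≠ 0)
    (f g : A → ℝ) (hfm : Measurable f) (hgm : Measurable g)
    (hfB : ∃ C, ∀ a, |f a| ≤ C) (hgB : ∃ C, ∀ a, |g a| ≤ C)
    (ε : ℝ) (hε : 0 ≤ ε)
    (hosc : ∀ a a', (f a - g a) - (f a' - g a') ≤ ε)
    (pi : A → ℝ) (hpim : Measurable pi) (hpi0 : ∀ a, 0 ≤ pi a)
    (hpi1 : ∫ a, pi a ∂μ = 1)
    (hpient : Integrable (fun a => pi a * |Real.log (pi a)|) μ) :
    |klDiv (μ.withDensity (fun a => ENNReal.ofReal (pi a))) (gibbs μ f) -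
        klDiv (μ.withDensity (fun a => ENNReal.ofReal (pi a))) (gibbs μ g)| ≤ ε := by
  have hpi : Integrable pi μ := by
    by_contra h
    simp [integral_undef h] at hpi1
  have hP : IsProbabilityMeasure (μ.withDensity (fun a => ENNReal.ofReal (pi a))) := by
    refine ⟨?_⟩
    rw [withDensity_apply _ MeasurableSet.univ, Measure.restrict_univ,
      ← ofReal_integral_eq_lintegral_ofReal hpi (.of_forall hpi0), hpi1, ENNReal.ofReal_one]
  have hac : μ.withDensity (fun a => ENNReal.ofReal (pi a)) ≪ μ :=
    withDensity_absolutelyContinuous _ _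
  have hint := integrable_llr_withDensity μ hpim hpi0 hpient
  rw [klDiv_gibbs μ _ hac hint hfm hfB, klDiv_gibbs μ _ hac hint hgm hgB, abs_le]
  have hfg := log_partitionZ_sub_le μ (μ.withDensity (fun a => ENNReal.ofReal (pi a))) hμ
    hfm hgm hfB hgB hosc
  have hgf := log_partitionZ_sub_le μ (μ.withDensity (fun a => ENNReal.ofReal (pi a))) hμ
    hgm hfm hgB hfB (ε := ε) fun a a' => by linarith [hosc a' a]
  constructor <;> linarith
end

section
/- Let f, g : A → ℝ be bounded measurable functions and ε ≥ 0 with osc(f − g) ≤ ε. Then |∫_A π(a)·ln( exp(f(a) − g(a))·Z(g)/Z(f) ) dμ(a)| ≤ ε; equivalently, |∫_A π·(f − g) dμ − ln( Z(f)/Z(g) )| ≤ ε. (This is inequality (26)/(27) in the appendix of the paper, the key estimate used to bound each term of the KL-divergence difference.) -/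
open MeasureTheory Real

theorem integrable_exp_of_bounded {A : Type*} [MeasurableSpace A] (μ : Measure A)
    [IsFiniteMeasure μ] {f : A → ℝ} (hfm : Measurable f) (hfB : ∃ C, ∀ a, |f a| ≤ C) :
    Integrable (fun a => Real.exp (f a)) μ := by
  obtain ⟨C, hC⟩ := hfB
  refine Integrable.of_bound hfm.exp.aestronglyMeasurable (Real.exp C) (.of_forall fun a => ?_)
  rw [Real.norm_eq_abs, Real.abs_exp]
  exact Real.exp_le_exp.2 ((le_abs_self _).trans (hC a))

theorem partitionZ_pos {A : Type*} [MeasurableSpace A] {μ : Measure A} [IsFiniteMeasure μ]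
    (hμ : μ ≠ 0) {f : A → ℝ} (hfm : Measurable f) (hfB : ∃ C, ∀ a, |f a| ≤ C) :
    0 < partitionZ μ f :=
  have : NeZero μ := ⟨hμ⟩
  integral_exp_pos (integrable_exp_of_bounded μ hfm hfB)

theorem partitionZ_le_exp_mul {A : Type*} [MeasurableSpace A] {μ : Measure A} [IsFiniteMeasure μ]
    {f g : A → ℝ} (hfm : Measurable f) (hgm : Measurable g)
    (hfB : ∃ C, ∀ a, |f a| ≤ C) (hgB : ∃ C, ∀ a, |g a| ≤ C) {c : ℝ} (h : ∀ a, f a ≤ c + g a) :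
    partitionZ μ f ≤ Real.exp c * partitionZ μ g := by
  unfold partitionZ
  rw [← integral_const_mul]
  refine integral_mono (integrable_exp_of_bounded μ hfm hfB)
    ((integrable_exp_of_bounded μ hgm hgB).const_mul _) fun a => ?_
  simp only [← Real.exp_add]
  exact Real.exp_le_exp.2 (h a)

theorem log_partitionZ_le {A : Type*} [MeasurableSpace A] {μ : Measure A} [IsFiniteMeasure μ]
    (hμ : μ ≠ 0) {f g : A → ℝ} (hfm : Measurable f) (hgm : Measurable g)
    (hfB : ∃ C, ∀ a, |f a| ≤ C) (hgB : ∃ C, ∀ a, |g a| ≤ C) {c : ℝ} (h : ∀ a, f a ≤ c + g a) :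
    Real.log (partitionZ μ f) ≤ c + Real.log (partitionZ μ g) := by
  have hle := Real.log_le_log (partitionZ_pos hμ hfm hfB)
    (partitionZ_le_exp_mul (μ := μ) hfm hgm hfB hgB h)
  rwa [Real.log_mul (Real.exp_pos c).ne' (partitionZ_pos hμ hgm hgB).ne', Real.log_exp] at hle

theorem stmt_2 {A : Type*} [MeasurableSpace A] (μ : Measure A) [IsFiniteMeasure μ]
    (hμ : μ ≠ 0)
    (f g : A → ℝ) (hfm : Measurable f) (hgm : Measurable g)
    (hfB : ∃ C, ∀ a, |f a| ≤ C) (hgB : ∃ C, ∀ a, |g a| ≤ C)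
    (ε : ℝ) (hε : 0 ≤ ε)
    (hosc : ∀ a a', (f a - g a) - (f a' - g a') ≤ ε)
    (pi : A → ℝ) (hpim : Measurable pi) (hpi0 : ∀ a, 0 ≤ pi a)
    (hpi1 : ∫ a, pi a ∂μ = 1) :
    |∫ a, pi a * Real.log (Real.exp (f a - g a) * partitionZ μ g / partitionZ μ f) ∂μ| ≤ ε ∧
    |(∫ a, pi a * (f a - g a) ∂μ) - Real.log (partitionZ μ f / partitionZ μ g)| ≤ ε := by
  have hZf := partitionZ_pos hμ hfm hfB
  have hZg := partitionZ_pos hμ hgm hgB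
  have hpi : Integrable pi μ := .of_integral_ne_zero (by simp [hpi1])
  have hlog : ∀ a, Real.log (Real.exp (f a - g a) * partitionZ μ g / partitionZ μ f)
      = (f a - g a) - Real.log (partitionZ μ f / partitionZ μ g) := fun a => by
    rw [Real.log_div (by positivity) hZf.ne', Real.log_mul (Real.exp_pos _).ne' hZg.ne',
      Real.log_exp, Real.log_div hZf.ne' hZg.ne']
    ring
  have hbound : ∀ a, |(f a - g a) - Real.log (partitionZ μ f / partitionZ μ g)| ≤ ε := fun a => by
    have h₁ := log_partitionZ_le hμ hfm hgm hfB hgB (c := f a - g a + ε)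
      fun b => by linarith [hosc b a]
    have h₂ := log_partitionZ_le hμ hgm hfm hgB hfB (c := ε - (f a - g a))
      fun b => by linarith [hosc a b]
    rw [Real.log_div hZf.ne' hZg.ne', abs_le]
    constructor <;> linarith
  have hint : Integrable (fun a => pi a * (f a - g a)) μ := by
    obtain ⟨C, hC⟩ := hfB
    obtain ⟨D, hD⟩ := hgB
    refine hpi.mul_bdd (c := C + D) (hfm.sub hgm).aestronglyMeasurable (.of_forall fun a => ?_)
    exact (abs_sub _ _).trans (add_le_add (hC a) (hD a))
  have heq : ∫ a, pi a * Real.log (Real.exp (f a - g a) * partitionZ μ g / partitionZ μ f) ∂μ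
      = (∫ a, pi a * (f a - g a) ∂μ) - Real.log (partitionZ μ f / partitionZ μ g) := by
    simp only [hlog, mul_sub _ (f _ - g _)]
    rw [integral_sub hint (hpi.mul_const _), integral_mul_const, hpi1, one_mul]
  have hmain :
      |∫ a, pi a * Real.log (Real.exp (f a - g a) * partitionZ μ g / partitionZ μ f) ∂μ| ≤ ε := by
    rw [← Real.norm_eq_abs]
    refine (norm_integral_le_of_norm_le (hpi.mul_const ε) (.of_forall fun a => ?_)).trans_eq ?_
    · rw [hlog, Real.norm_eq_abs, abs_mul, abs_of_nonneg (hpi0 a)]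
      exact mul_le_mul_of_nonneg_left (hbound a) (hpi0 a)
    · rw [integral_mul_const, hpi1, one_mul]
  exact ⟨hmain, heq ▸ hmain⟩
end
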